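/- Let n be a natural number, p : Fin n → ℝ with p i ≥ 0 and ∑ p i = 1, and let C i be Clifford unitaries for each i, and set ϱ = ∑_i p i · (I₂ ⊗ C i) P_Φ (I₂ ⊗ C i)†. Then ϱ satisfies every CHSH Bell inequality with Pauli measurements: for all j₁ ≠ j₂ and k₁ ≠ k₂ in {x, y, z} and all signs s, t, u ∈ {−1, +1}, s·c_{j₁k₁}(ϱ) + t·c_{j₁k₂}(ϱ) + u·c_{j₂k₁}(ϱ) − s·t·u·c_{j₂k₂}(ϱ) ≤ 2. (Hence no CHSH violation is possible using only stabilizer operations.) -/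

import Mathlib

open Matrix Kronecker
open scoped ComplexOrder

noncomputable section

/-- The Pauli matrices σx, σy, σz, indexed by `Fin 3` (0 ↦ x, 1 ↦ y, 2 ↦ z). -/
def pauli : Fin 3 → Matrix (Fin 2) (Fin 2) ℂ :=
  ![!![0, 1; 1, 0], !![0, -Complex.I; Complex.I, 0], !![1, 0; 0, -1]]

/-- Pauli correlation `c_{jk}(ϱ) = Re Tr(ϱ (σj ⊗ σk))` for a two-qubit matrix `ϱ`
(indexed by `Fin 2 × Fin 2`, first qubit is the left Kronecker factor). -/
def corr (j k : Fin 3) (ϱ : Matrix (Fin 2 × Fin 2) (Fin 2 × Fin 2) ℂ) : ℝ :=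
  ((ϱ * (pauli j ⊗ₖ pauli k)).trace).re

/-- The projection onto the maximally entangled state `Φ = (|00⟩+|11⟩)/√2`:
entries `1/2` at row/column indices `00` and `11`, zero elsewhere. -/
def PΦ : Matrix (Fin 2 × Fin 2) (Fin 2 × Fin 2) ℂ :=
  fun i j => if i.1 = i.2 ∧ j.1 = j.2 then 1/2 else 0

/-- A 2×2 unitary `C` is a Clifford unitary if it maps every Pauli matrix to a
signed Pauli matrix under conjugation. -/
def IsClifford (C : Matrix (Fin 2) (Fin 2) ℂ) : Prop :=
  C ∈ Matrix.unitaryGroup (Fin 2) ℂ ∧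
    ∀ j : Fin 3, ∃ k : Fin 3, ∃ ε : ℝ, (ε = -1 ∨ ε = 1) ∧
      C * pauli j * Cᴴ = (ε : ℂ) • pauli k

/-- Correlations of a Choi state of `C` reduce to a trace over the second qubit. -/
lemma trace_choi_mul_kronecker (A B C : Matrix (Fin 2) (Fin 2) ℂ) :
    (((1 : Matrix (Fin 2) (Fin 2) ℂ) ⊗ₖ C) * PΦ * ((1 : Matrix (Fin 2) (Fin 2) ℂ) ⊗ₖ C)ᴴ
      * (A ⊗ₖ B)).trace = 1 / 2 * (C * Aᵀ * Cᴴ * B).trace := by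
  simp [Matrix.trace, Matrix.mul_apply, Fintype.sum_prod_type, PΦ, Fin.sum_univ_two,
    Matrix.one_apply]
  ring

lemma exists_pauli_transpose (j : Fin 3) :
    ∃ δ : ℝ, |δ| = 1 ∧ (pauli j)ᵀ = (δ : ℂ) • pauli j := by
  fin_cases j
  · exact ⟨1, by simp, by ext a b; fin_cases a <;> fin_cases b <;> simp [pauli]⟩
  · exact ⟨-1, by simp, by ext a b; fin_cases a <;> fin_cases b <;> simp [pauli]⟩
  · exact ⟨1, by simp, by ext a b; fin_cases a <;> fin_cases b <;> simp [pauli]⟩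

lemma trace_pauli_mul_pauli (j k : Fin 3) :
    (pauli j * pauli k).trace = if k = j then 2 else 0 := by
  fin_cases j <;> fin_cases k <;>
    simp [pauli, Matrix.trace, Fin.sum_univ_two] <;> norm_num

/-- Each row of the correlation matrix of a Clifford Choi state has a single nonzero entry,
which is a sign. -/
lemma IsClifford.exists_corr_choi {C : Matrix (Fin 2) (Fin 2) ℂ} (hC : IsClifford C) (j : Fin 3) :
    ∃ (m : Fin 3) (δ : ℝ), |δ| = 1 ∧ ∀ k,
      corr j k (((1 : Matrix (Fin 2) (Fin 2) ℂ) ⊗ₖ C) * PΦ *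
        ((1 : Matrix (Fin 2) (Fin 2) ℂ) ⊗ₖ C)ᴴ) = if k = m then δ else 0 := by
  obtain ⟨m, ε, hε, hm⟩ := hC.2 j
  obtain ⟨δ, hδ, ht⟩ := exists_pauli_transpose j
  refine ⟨m, δ * ε, ?_, fun k => ?_⟩
  · rcases hε with rfl | rfl <;> simp [hδ]
  · rw [corr, trace_choi_mul_kronecker, ht, mul_smul_comm, smul_mul_assoc, hm, smul_smul,
      smul_mul_assoc, trace_smul, trace_pauli_mul_pauli]
    split_ifs
    · simp
      ring
    · simp

lemma IsClifford.signed_corr_choi_le_one {C : Matrix (Fin 2) (Fin 2) ℂ} (hC : IsClifford C)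
    (j : Fin 3) {k₁ k₂ : Fin 3} (hk : k₁ ≠ k₂) {a b : ℝ} (ha : |a| = 1) (hb : |b| = 1) :
    a * corr j k₁ (((1 : Matrix (Fin 2) (Fin 2) ℂ) ⊗ₖ C) * PΦ *
        ((1 : Matrix (Fin 2) (Fin 2) ℂ) ⊗ₖ C)ᴴ) +
      b * corr j k₂ (((1 : Matrix (Fin 2) (Fin 2) ℂ) ⊗ₖ C) * PΦ *
        ((1 : Matrix (Fin 2) (Fin 2) ℂ) ⊗ₖ C)ᴴ) ≤ 1 := by
  obtain ⟨m, δ, hδ, h⟩ := hC.exists_corr_choi j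
  have haδ : a * δ ≤ 1 := (le_abs_self _).trans (by rw [abs_mul, ha, hδ, one_mul])
  have hbδ : b * δ ≤ 1 := (le_abs_self _).trans (by rw [abs_mul, hb, hδ, one_mul])
  rw [h, h]
  split_ifs with h₁ h₂ h₂
  · exact absurd (h₁.trans h₂.symm) hk
  all_goals linarith

lemma corr_sum_smul {ι : Type*} [Fintype ι] (j k : Fin 3) (p : ι → ℝ)
    (R : ι → Matrix (Fin 2 × Fin 2) (Fin 2 × Fin 2) ℂ) :
    corr j k (∑ i, (p i : ℂ) • R i) = ∑ i, p i * corr j k (R i) := by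
  simp [corr, Finset.sum_mul, trace_sum]

/-- Indices: 0 = x, 1 = y, 2 = z. Any mixture of Clifford Choi states satisfies every
CHSH Bell inequality with Pauli measurements: no CHSH violation is possible using
only stabilizer operations. -/
theorem clifford_mixture_satisfies_all_chsh
    (n : ℕ) (p : Fin n → ℝ) (hp : ∀ i, 0 ≤ p i) (hsum : ∑ i, p i = 1)
    (C : Fin n → Matrix (Fin 2) (Fin 2) ℂ) (hC : ∀ i, IsClifford (C i))
    (ϱ : Matrix (Fin 2 × Fin 2) (Fin 2 × Fin 2) ℂ)
    (hϱ : ϱ = ∑ i, (p i : ℂ) •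
      (((1 : Matrix (Fin 2) (Fin 2) ℂ) ⊗ₖ C i) * PΦ *
        ((1 : Matrix (Fin 2) (Fin 2) ℂ) ⊗ₖ C i)ᴴ)) :
    ∀ (j₁ j₂ k₁ k₂ : Fin 3), j₁ ≠ j₂ → k₁ ≠ k₂ →
      ∀ s t u : ℝ, (s = -1 ∨ s = 1) → (t = -1 ∨ t = 1) → (u = -1 ∨ u = 1) →
        s * corr j₁ k₁ ϱ + t * corr j₁ k₂ ϱ + u * corr j₂ k₁ ϱ
          - s * t * u * corr j₂ k₂ ϱ ≤ 2 := by
  intro j₁ j₂ k₁ k₂ _ hk s t u hs ht hu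
  have abs_sign {x : ℝ} (hx : x = -1 ∨ x = 1) : |x| = 1 := by
    rcases hx with rfl | rfl <;> simp
  have hstu : |-(s * t * u)| = 1 := by
    simp [abs_mul, abs_sign hs, abs_sign ht, abs_sign hu]
  rw [hϱ]
  simp only [corr_sum_smul, Finset.mul_sum]
  rw [← Finset.sum_add_distrib, ← Finset.sum_add_distrib, ← Finset.sum_sub_distrib]
  calc
    _ ≤ ∑ i, p i * 2 := Finset.sum_le_sum fun i _ => by
      have h₁ := (hC i).signed_corr_choi_le_one j₁ hk (abs_sign hs) (abs_sign ht)
      have h₂ := (hC i).signed_corr_choi_le_one j₂ hk (abs_sign hu) hstu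
      linarith [mul_le_mul_of_nonneg_left (add_le_add h₁ h₂) (hp i)]
    _ = 2 := by rw [← Finset.sum_mul, hsum, one_mul]
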